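/- (Proposition 3.2(ii).) Assume there exist constants 0 < c ≤ C < ∞ such that ḡ and f̄ take values in [c, C] and |μ̄_k| ≤ C for all k. Then there exist ρ ∈ (0,1) and C' < ∞, depending only on c, C and E, such that for all L, n ∈ ℕ with n ≥ L+1 and every bounded measurable φ : E → ℝ: | \tilde{π}_{1,n,n}(φ) − π_{(n)}(φ) | ≤ C' · ‖φ‖_∞ · ‖μ̄^e_{n-L} − π_{(n-L+1|n-L)}‖_TV · ρ^L, where ‖μ−ν‖_TV := sup_A |μ(A) − ν(A)| and μ̄^e_{n-L} denotes the probability measure on E with density proportional to μ^e_{n-L}. -/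

import Mathlib

open MeasureTheory
open scoped ENNReal NNReal

/-- Total variation distance `‖μ−ν‖_TV := sup_A |μ(A) − ν(A)|`, supremum over measurable sets. -/
noncomputable def tvDist {α : Type*} [MeasurableSpace α] (μ ν : Measure α) : ℝ :=
  ⨆ s : {s : Set α // MeasurableSet s}, |(μ s.1).toReal - (ν s.1).toReal|

/-- Normalization of the measure with density `ρ` with respect to `base`:
the "probability measure with density proportional to `ρ`". -/
noncomputable def normMeasure {α : Type*} [MeasurableSpace α] (base : Measure α) (ρ : α → ℝ) :
    Measure α :=
  (∫⁻ a, ENNReal.ofReal (ρ a) ∂base)⁻¹ • base.withDensity fun a => ENNReal.ofReal (ρ a)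

/-- Lebesgue measure on a subset `E ⊂ ℝ`, viewed as a measure on the subtype `↥E`. -/
noncomputable def subMeasure (E : Set ℝ) : Measure ↥E :=
  MeasureTheory.volume.comap Subtype.val

/-- The previous state `x_{i-1}` of a path (0-based), with the state before `x_1` being `x₀`. -/
def prevCoord {S : Type*} (x0 : S) {n : ℕ} (x : Fin n → S) (i : Fin n) : S :=
  if (i : ℕ) = 0 then x0 else x ⟨(i : ℕ) - 1, lt_of_le_of_lt (Nat.sub_le _ _) i.isLt⟩

/-- The unnormalized smoothing density `∏_{p=1}^n f(x_{p-1},x_p) g(x_p,y_p)`. -/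
noncomputable def smoothDensity {S Y : Type*} (f : S → S → ℝ) (g : S → Y → ℝ)
    (x0 : S) (y : ℕ → Y) (n : ℕ) (x : Fin n → S) : ℝ :=
  ∏ i : Fin n, (f (prevCoord x0 x i) (x i) * g (x i) (y ((i : ℕ) + 1)))

/-- The true filter `π_{(n)}`: the time-`n` marginal of the probability measure on `S^n`
with density proportional to `∏_{p=1}^n f(x_{p-1},x_p) g(x_p,y_p)`. -/
noncomputable def filterMarginal {S Y : Type*} [MeasurableSpace S] (base : Measure S)
    (f : S → S → ℝ) (g : S → Y → ℝ) (x0 : S) (y : ℕ → Y) (n : ℕ) (hn : 1 ≤ n) : Measure S :=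
  (normMeasure (Measure.pi fun _ : Fin n => base) (smoothDensity f g x0 y n)).map
    (fun x => x ⟨n - 1, by omega⟩)

/-- The predictive distribution `π_{(n-L+1|n-L)}`: the probability measure on `S` with density
`x' ↦ ∫ π_{(n-L)}(x) f(x,x') dx`. -/
noncomputable def predictiveMeasure {S Y : Type*} [MeasurableSpace S] (base : Measure S)
    (f : S → S → ℝ) (g : S → Y → ℝ) (x0 : S) (y : ℕ → Y) (k : ℕ) (hk : 1 ≤ k) : Measure S :=
  base.withDensity fun x' =>
    ENNReal.ofReal (∫ z, f z x' ∂(filterMarginal base f g x0 y k hk))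

/-- The density of the lagged block `(x_{n-L+1},…,x_n)`:
`μ_{n-L}(x_{n-L+1}) g(x_{n-L+1},y_{n-L+1}) ∏_{p=n-L+2}^{n} f(x_{p-1},x_p) g(x_p,y_p)`,
in block-local coordinates `Fin L → S` (index `t` corresponds to time `n-L+1+t`). -/
noncomputable def laggedBlockDensity {S Y : Type*} (f : S → S → ℝ) (g : S → Y → ℝ)
    (μ : ℕ → S → ℝ) (y : ℕ → Y) (L n : ℕ) (hL : 1 ≤ L) (x : Fin L → S) : ℝ :=
  μ (n - L) (x ⟨0, by omega⟩) * g (x ⟨0, by omega⟩) (y (n - L + 1)) *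
    ∏ t : Fin L,
      if 1 ≤ (t : ℕ) then
        f (x ⟨(t : ℕ) - 1, lt_of_le_of_lt (Nat.sub_le _ _) t.isLt⟩) (x t) *
          g (x t) (y (n - L + 1 + (t : ℕ)))
      else 1

/-- The lagged final-time marginal `π̃_{1,n,n}`: the time-`n` marginal of the probability
measure on `S^L`, in variables `(x_{n-L+1},…,x_n)`, with density proportional to the lagged
block density. -/
noncomputable def laggedFilterMarginal {S Y : Type*} [MeasurableSpace S] (base : Measure S)
    (f : S → S → ℝ) (g : S → Y → ℝ) (μ : ℕ → S → ℝ) (y : ℕ → Y) (L n : ℕ) (hL : 1 ≤ L) :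
    Measure S :=
  (normMeasure (Measure.pi fun _ : Fin L => base) (laggedBlockDensity f g μ y L n hL)).map
    (fun x => x ⟨L - 1, by omega⟩)

section Paths

variable {S Y : Type*}

/-- The weight `∏ᵢ qᵢ(x_{i-1}, x_i)` of a path started at `x0`. -/
noncomputable def pathWeight (q : ℕ → S → S → ℝ) (x0 : S) {n : ℕ} (x : Fin n → S) : ℝ :=
  ∏ i : Fin n, q i (prevCoord x0 x i) (x i)

/-- The final state of a path started at `x0`. -/
def finalState (x0 : S) {n : ℕ} (x : Fin n → S) : S :=
  if h : n = 0 then x0 else x ⟨n - 1, by omega⟩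

lemma prevCoord_cons_zero (x0 z : S) {n : ℕ} (x : Fin n → S) :
    prevCoord x0 (Fin.cons z x : Fin (n + 1) → S) 0 = x0 := by
  simp [prevCoord]

lemma prevCoord_cons_succ (x0 z : S) {n : ℕ} (x : Fin n → S) (i : Fin n) :
    prevCoord x0 (Fin.cons z x : Fin (n + 1) → S) i.succ = prevCoord z x i := by
  obtain ⟨i, hi⟩ := i
  cases i with
  | zero => simp [prevCoord]
  | succ j =>
    simp only [prevCoord, Fin.succ_mk, Nat.add_eq_zero_iff, one_ne_zero, and_false, if_false,
      Nat.add_sub_cancel]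
    exact Fin.cons_succ (α := fun _ => S) z x ⟨j, by omega⟩

lemma pathWeight_cons (q : ℕ → S → S → ℝ) (x0 z : S) {n : ℕ} (x : Fin n → S) :
    pathWeight q x0 (Fin.cons z x : Fin (n + 1) → S) =
      q 0 x0 z * pathWeight (fun i => q (i + 1)) z x := by
  simp [pathWeight, Fin.prod_univ_succ, prevCoord_cons_zero, prevCoord_cons_succ]

lemma finalState_cons (x0 z : S) {n : ℕ} (x : Fin n → S) :
    finalState x0 (Fin.cons z x : Fin (n + 1) → S) = finalState z x := by
  cases n with
  | zero => simp only [finalState]; simp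
  | succ n =>
    simp only [finalState, Nat.add_eq_zero_iff, one_ne_zero, and_false, dite_false,
      Nat.add_sub_cancel]
    exact Fin.cons_succ (α := fun _ => S) z x ⟨n, by omega⟩

/-- The one-step kernels `f(x,z) g(z, y_{s+i+1})`. -/
def stepKernel (f : S → S → ℝ) (g : S → Y → ℝ) (y : ℕ → Y) (s i : ℕ) (x z : S) : ℝ :=
  f x z * g z (y (s + i + 1))

/-- The one-step kernels of the lagged block, whose first kernel ignores the previous state. -/
def laggedKernel (f : S → S → ℝ) (g : S → Y → ℝ) (w : S → ℝ) (y : ℕ → Y) (s : ℕ) :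
    ℕ → S → S → ℝ
  | 0, _, z => w z * g z (y (s + 1))
  | i + 1, x, z => f x z * g z (y (s + 1 + i + 1))

lemma laggedBlockDensity_eq_pathWeight (f : S → S → ℝ) (g : S → Y → ℝ) (μ : ℕ → S → ℝ)
    (y : ℕ → Y) (L n : ℕ) (hL : 1 ≤ L)
    (x0 : S) (x : Fin L → S) :
    laggedBlockDensity f g μ y L n hL x =
      pathWeight (laggedKernel f g (μ (n - L)) y (n - L)) x0 x := by
  obtain ⟨k, rfl⟩ : ∃ k, L = k + 1 := ⟨L - 1, by omega⟩
  simp [laggedBlockDensity, pathWeight, Fin.prod_univ_succ, laggedKernel, prevCoord, add_assoc]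

lemma finalState_of_pos (x0 : S) {n : ℕ} (hn : 1 ≤ n) :
    (fun x : Fin n → S => x ⟨n - 1, by omega⟩) = fun x => finalState x0 x := by
  funext x
  rw [finalState, dif_neg (by omega)]

end Paths

section BackwardRecursion

variable {S : Type*} [MeasurableSpace S]

/-- A sequence of jointly measurable kernel densities with values in `[a, b]`, `0 < a`. -/
structure IsBddPosKernel (q : ℕ → S → S → ℝ) (a b : ℝ) : Prop where
  measurable : ∀ i, Measurable (Function.uncurry (q i))
  pos : 0 < a
  mem_Icc : ∀ i x z, q i x z ∈ Set.Icc a b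

/-- The backward recursion `x ↦ ∫ q₀(x,z₁) q₁(z₁,z₂) ⋯ q_{n-1}(z_{n-1},z_n) φ(z_n) dz`. -/
noncomputable def backward (base : Measure S) : (ℕ → S → S → ℝ) → ℕ → (S → ℝ) → S → ℝ
  | _, 0, φ => φ
  | q, n + 1, φ => fun x => ∫ z, q 0 x z * backward base (fun i => q (i + 1)) n φ z ∂base

variable {q : ℕ → S → S → ℝ} {a b : ℝ}

namespace IsBddPosKernel

lemma shift (hq : IsBddPosKernel q a b) (k : ℕ) : IsBddPosKernel (fun i => q (i + k)) a b :=
  ⟨fun _ => hq.measurable _, hq.pos, fun _ => hq.mem_Icc _⟩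

lemma upper_pos [Nonempty S] (hq : IsBddPosKernel q a b) : 0 < b :=
  let ⟨x⟩ := ‹Nonempty S›
  hq.pos.trans_le ((hq.mem_Icc 0 x x).1.trans (hq.mem_Icc 0 x x).2)

lemma abs_le (hq : IsBddPosKernel q a b) (i : ℕ) (x z : S) : |q i x z| ≤ b := by
  rw [abs_of_nonneg (hq.pos.le.trans (hq.mem_Icc i x z).1)]
  exact (hq.mem_Icc i x z).2

end IsBddPosKernel

lemma integrable_of_abs_le {μ : Measure S} [IsFiniteMeasure μ] {f : S → ℝ} (hf : Measurable f)
    (M : ℝ) (hM : ∀ x, |f x| ≤ M) : Integrable f μ :=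
  Integrable.of_bound hf.aestronglyMeasurable M (Filter.Eventually.of_forall hM)

lemma integral_pos_of_const_le {μ : Measure S} [IsFiniteMeasure μ] [NeZero μ] {f : S → ℝ} {m : ℝ}
    (hm : 0 < m) (hf : Integrable f μ) (h : ∀ x, m ≤ f x) : 0 < ∫ x, f x ∂μ := by
  have h0 := integral_mono (integrable_const m) hf h
  rw [integral_const, smul_eq_mul] at h0
  exact (mul_pos measureReal_univ_pos hm).trans_le h0

lemma measurable_backward (base : Measure S) [IsFiniteMeasure base] (hq : IsBddPosKernel q a b)
    {φ : S → ℝ} (hφ : Measurable φ) (n : ℕ) : Measurable (backward base q n φ) := by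
  induction n generalizing q with
  | zero => exact hφ
  | succ n ih =>
    have h : Measurable (Function.uncurry fun x z =>
        q 0 x z * backward base (fun i => q (i + 1)) n φ z) :=
      (hq.measurable 0).mul ((ih (hq.shift 1)).comp measurable_snd)
    exact h.stronglyMeasurable.integral_prod_right.measurable

lemma exists_abs_backward_le (base : Measure S) [IsFiniteMeasure base]
    (hq : IsBddPosKernel q a b) {φ : S → ℝ} {M : ℝ} (hM : ∀ x, |φ x| ≤ M) (n : ℕ) :
    ∃ M', ∀ x, |backward base q n φ x| ≤ M' := by
  induction n generalizing q with
  | zero => exact ⟨M, hM⟩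
  | succ n ih =>
    obtain ⟨K, hK⟩ := ih (hq.shift 1)
    refine ⟨b * K * base.real Set.univ, fun x => ?_⟩
    refine norm_integral_le_of_norm_le_const (μ := base) (G := ℝ) (Filter.Eventually.of_forall fun z => ?_)
    rw [norm_mul]
    exact mul_le_mul (hq.abs_le _ _ _) (hK z) (norm_nonneg _)
      ((abs_nonneg _).trans (hq.abs_le 0 x z))

lemma integrable_mul_backward (base : Measure S) [IsFiniteMeasure base]
    (hq : IsBddPosKernel q a b) {φ : S → ℝ} (hφ : Measurable φ) {M : ℝ} (hM : ∀ x, |φ x| ≤ M)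
    {w : S → ℝ} (hw : Measurable w) {K : ℝ} (hK : ∀ z, |w z| ≤ K) (n : ℕ) :
    Integrable (fun z => w z * backward base q n φ z) base := by
  obtain ⟨M', hM'⟩ := exists_abs_backward_le base hq hM n
  refine integrable_of_abs_le (hw.mul (measurable_backward base hq hφ n)) (K * M') fun z => ?_
  rw [abs_mul]
  exact mul_le_mul (hK z) (hM' z) (abs_nonneg _) ((abs_nonneg _).trans (hK z))

lemma backward_add (base : Measure S) (q : ℕ → S → S → ℝ) (m n : ℕ) (φ : S → ℝ) :
    backward base q (m + n) φ =
      backward base q m (backward base (fun i => q (i + m)) n φ) := by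
  induction m generalizing q with
  | zero => simp [backward]
  | succ m ih =>
    rw [show m + 1 + n = (m + n) + 1 by ring]
    funext x
    simp only [backward, ih]
    simp only [add_assoc]

lemma measurable_prevCoord (x0 : S) {n : ℕ} (i : Fin n) :
    Measurable fun x : Fin n → S => prevCoord x0 x i := by
  unfold prevCoord
  split_ifs
  · exact measurable_const
  · exact measurable_pi_apply _

lemma measurable_pathWeight (hq : IsBddPosKernel q a b) (x0 : S) (n : ℕ) :
    Measurable fun x : Fin n → S => pathWeight q x0 x :=
  Finset.measurable_prod _ fun i _ =>
    (hq.measurable i).comp ((measurable_prevCoord x0 i).prodMk (measurable_pi_apply i))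

lemma measurable_finalState (x0 : S) (n : ℕ) :
    Measurable fun x : Fin n → S => finalState x0 x := by
  unfold finalState
  split_ifs
  · exact measurable_const
  · exact measurable_pi_apply _

lemma pathWeight_nonneg (hq : IsBddPosKernel q a b) (x0 : S) {n : ℕ} (x : Fin n → S) :
    0 ≤ pathWeight q x0 x :=
  Finset.prod_nonneg fun _ _ => hq.pos.le.trans (hq.mem_Icc _ _ _).1

lemma pathWeight_le (hq : IsBddPosKernel q a b) (x0 : S) {n : ℕ} (x : Fin n → S) :
    pathWeight q x0 x ≤ b ^ n := by
  refine (Finset.prod_le_prod (g := fun _ => b)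
    (fun _ _ => hq.pos.le.trans (hq.mem_Icc _ _ _).1)
    fun _ _ => (hq.mem_Icc _ _ _).2).trans_eq ?_
  simp

lemma integrable_pathWeight_mul (base : Measure S) [IsFiniteMeasure base]
    (hq : IsBddPosKernel q a b) {φ : S → ℝ} (hφ : Measurable φ) {M : ℝ} (hM : ∀ x, |φ x| ≤ M)
    (x0 : S) (n : ℕ) :
    Integrable (fun x : Fin n → S => pathWeight q x0 x * φ (finalState x0 x))
      (Measure.pi fun _ : Fin n => base) := by
  refine integrable_of_abs_le ((measurable_pathWeight hq x0 n).mul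
    (hφ.comp (measurable_finalState x0 n))) (b ^ n * M) fun x => ?_
  rw [abs_mul, abs_of_nonneg (pathWeight_nonneg hq x0 x)]
  exact mul_le_mul (pathWeight_le hq x0 x) (hM _) (abs_nonneg _)
    ((pathWeight_nonneg hq x0 x).trans (pathWeight_le hq x0 x))

/-- Integrating the final state against the path weight is the backward recursion. -/
lemma integral_pathWeight_mul (base : Measure S) [IsFiniteMeasure base]
    (hq : IsBddPosKernel q a b) {φ : S → ℝ} (hφ : Measurable φ) {M : ℝ} (hM : ∀ x, |φ x| ≤ M)
    (x0 : S) (n : ℕ) :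
    ∫ x : Fin n → S, pathWeight q x0 x * φ (finalState x0 x) ∂(Measure.pi fun _ => base) =
      backward base q n φ x0 := by
  induction n generalizing q x0 with
  | zero =>
    rw [Measure.pi_of_empty, integral_dirac]
    simp [pathWeight, finalState, backward]
  | succ n ih =>
    have mp := (measurePreserving_piFinSuccAbove (fun _ : Fin (n + 1) => base) 0).symm
    have hint := integrable_pathWeight_mul base hq hφ hM x0 (n + 1)
    rw [← mp.integral_comp', integral_prod]
    · simp only [backward]
      congr 1
      funext z
      rw [← ih (hq.shift 1) z, ← integral_const_mul]
      congr 1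
      funext x
      rw [MeasurableEquiv.piFinSuccAbove_symm_apply, Fin.insertNthEquiv_zero]
      change pathWeight q x0 (Fin.cons z x : Fin (n + 1) → S) *
        φ (finalState x0 (Fin.cons z x : Fin (n + 1) → S)) = _
      rw [pathWeight_cons, finalState_cons, mul_assoc]
    · exact mp.integrable_comp_of_integrable hint

end BackwardRecursion

section Contraction

variable {S : Type*} [MeasurableSpace S] {q : ℕ → S → S → ℝ} {a b : ℝ}

lemma IsBddPosKernel.integral_bounds (base : Measure S) (hq : IsBddPosKernel q a b)
    {w : S → ℝ} (hw : ∀ z, 0 ≤ w z) (x : S) (hint : Integrable w base)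
    (hqint : Integrable (fun z => q 0 x z * w z) base) :
    a * ∫ z, w z ∂base ≤ ∫ z, q 0 x z * w z ∂base ∧
      ∫ z, q 0 x z * w z ∂base ≤ b * ∫ z, w z ∂base := by
  constructor <;> rw [← integral_const_mul]
  · exact integral_mono (hint.const_mul a) hqint fun z =>
      mul_le_mul_of_nonneg_right (hq.mem_Icc 0 x z).1 (hw z)
  · exact integral_mono hqint (hint.const_mul b) fun z =>
      mul_le_mul_of_nonneg_right (hq.mem_Icc 0 x z).2 (hw z)

lemma integrable_backward (base : Measure S) [IsFiniteMeasure base]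
    (hq : IsBddPosKernel q a b) {φ : S → ℝ} (hφ : Measurable φ) {M : ℝ} (hM : ∀ x, |φ x| ≤ M)
    (n : ℕ) : Integrable (backward base q n φ) base := by
  simpa using integrable_mul_backward base hq hφ hM (w := fun _ => 1) measurable_const
    (K := 1) (by simp) n

lemma integrable_kernel_mul_backward (base : Measure S) [IsFiniteMeasure base]
    (hq : IsBddPosKernel q a b) {φ : S → ℝ} (hφ : Measurable φ) {M : ℝ} (hM : ∀ x, |φ x| ≤ M)
    (x : S) (n : ℕ) :
    Integrable (fun z => q 0 x z * backward base (fun i => q (i + 1)) n φ z) base :=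
  integrable_mul_backward base (hq.shift 1) hφ hM
    ((hq.measurable 0).comp measurable_prodMk_left) (hq.abs_le 0 x) n

/-- The backward recursion applied to `1` is comparable to a constant. -/
lemma exists_backward_one_bounds (base : Measure S) [IsFiniteMeasure base] [NeZero base]
    (hq : IsBddPosKernel q a b) (n : ℕ) :
    ∃ m, 0 < m ∧ ∀ x, m ≤ backward base q n (fun _ => 1) x ∧
      backward base q n (fun _ => 1) x ≤ b / a * m := by
  have ha := hq.pos
  have : Nonempty S := base.nonempty_of_neZero
  induction n generalizing q with
  | zero =>
    refine ⟨1, one_pos, fun x => ⟨le_rfl, ?_⟩⟩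
    simp only [backward, mul_one]
    rw [one_le_div ha]
    exact (hq.mem_Icc 0 x x).1.trans (hq.mem_Icc 0 x x).2
  | succ n ih =>
    obtain ⟨m, hm, h⟩ := ih (hq.shift 1)
    have hint := integrable_backward base (hq.shift 1) (φ := fun _ => 1) measurable_const
      (M := 1) (by simp) n
    have hI : 0 < ∫ z, backward base (fun i => q (i + 1)) n (fun _ => 1) z ∂base :=
      integral_pos_of_const_le hm hint fun z => (h z).1
    refine ⟨a * ∫ z, backward base (fun i => q (i + 1)) n (fun _ => 1) z ∂base,
      mul_pos ha hI, fun x => ?_⟩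
    have hb := hq.integral_bounds base (fun z => hm.le.trans (h z).1) x hint
      (integrable_kernel_mul_backward base hq measurable_const (M := 1) (by simp) x n)
    refine ⟨hb.1, hb.2.trans_eq ?_⟩
    field_simp

/-- The ratio of the backward recursions applied to `φ` and to `1` has geometrically
contracting oscillation. -/
lemma exists_backward_ratio_bounds (base : Measure S) [IsFiniteMeasure base] [NeZero base]
    (hq : IsBddPosKernel q a b) {φ : S → ℝ} (hφ : Measurable φ) {M : ℝ} (hM : ∀ x, |φ x| ≤ M)
    (n : ℕ) :
    ∃ l u, l ≤ u ∧ u - l ≤ 2 * M * (1 - a / b) ^ n ∧ ∀ x,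
      l * backward base q n (fun _ => 1) x ≤ backward base q n φ x ∧
      backward base q n φ x ≤ u * backward base q n (fun _ => 1) x := by
  have ha := hq.pos
  have : Nonempty S := base.nonempty_of_neZero
  have hb := hq.upper_pos
  have hab : a / b ≤ 1 := by
    obtain ⟨x⟩ := this
    rw [div_le_one hb]
    exact (hq.mem_Icc 0 x x).1.trans (hq.mem_Icc 0 x x).2
  induction n generalizing q with
  | zero =>
    have hM0 : 0 ≤ M := (abs_nonneg _).trans (hM this.some)
    refine ⟨-M, M, by linarith, by simp; linarith, fun x => ?_⟩
    simpa [backward] using abs_le.1 (hM x)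
  | succ n ih =>
    obtain ⟨l, u, hlu, hd, h⟩ := ih (hq.shift 1)
    obtain ⟨m, hm, hmB⟩ := exists_backward_one_bounds base (hq.shift 1) n
    set h1 := backward base (fun i => q (i + 1)) n (fun _ => 1) with h1_def
    set hφ' := backward base (fun i => q (i + 1)) n φ with hφ'_def
    have i1 : Integrable h1 base :=
      integrable_backward base (hq.shift 1) measurable_const (M := 1) (by simp) n
    have iφ : Integrable hφ' base := integrable_backward base (hq.shift 1) hφ hM n
    have j1 (x : S) : Integrable (fun z => q 0 x z * h1 z) base :=
      integrable_kernel_mul_backward base hq measurable_const (M := 1) (by simp) x n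
    have jφ (x : S) : Integrable (fun z => q 0 x z * hφ' z) base :=
      integrable_kernel_mul_backward base hq hφ hM x n
    set I := ∫ z, h1 z ∂base with hI_def
    set J := ∫ z, hφ' z ∂base with hJ_def
    have hI : 0 < I := integral_pos_of_const_le hm i1 fun z => (hmB z).1
    have hlJ : l * I ≤ J := by
      rw [hI_def, ← integral_const_mul]
      exact integral_mono (i1.const_mul l) iφ fun z => (h z).1
    have huJ : J ≤ u * I := by
      rw [hI_def, ← integral_const_mul]
      exact integral_mono iφ (i1.const_mul u) fun z => (h z).2
    have hab' : 0 ≤ 1 - a / b := by linarith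
    refine ⟨a / b * (J / I) + (1 - a / b) * l, a / b * (J / I) + (1 - a / b) * u, ?_, ?_,
      fun x => ?_⟩
    · gcongr
    · calc _ = (1 - a / b) * (u - l) := by ring
        _ ≤ (1 - a / b) * (2 * M * (1 - a / b) ^ n) := by gcongr
        _ = _ := by ring
    · have hQ1 := (hq.integral_bounds base (fun z => hm.le.trans (hmB z).1) x i1 (j1 x)).2
      have e1 (z : S) : q 0 x z * (hφ' z - l * h1 z) =
          q 0 x z * hφ' z - l * (q 0 x z * h1 z) := by ring
      have e2 (z : S) : q 0 x z * (u * h1 z - hφ' z) =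
          u * (q 0 x z * h1 z) - q 0 x z * hφ' z := by ring
      have hQl := (hq.integral_bounds base (w := fun z => hφ' z - l * h1 z)
        (fun z => sub_nonneg.2 (h z).1) x (iφ.sub (i1.const_mul l))
        (by simp only [e1]; exact (jφ x).sub ((j1 x).const_mul l))).1
      have hQu := (hq.integral_bounds base (w := fun z => u * h1 z - hφ' z)
        (fun z => sub_nonneg.2 (h z).2) x ((i1.const_mul u).sub iφ)
        (by simp only [e2]; exact ((j1 x).const_mul u).sub (jφ x))).1
      simp only [e1] at hQl
      simp only [e2] at hQu
      rw [integral_sub iφ (i1.const_mul l), integral_sub (jφ x) ((j1 x).const_mul l),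
        integral_const_mul, integral_const_mul] at hQl
      rw [integral_sub (i1.const_mul u) iφ, integral_sub ((j1 x).const_mul u) (jφ x),
        integral_const_mul, integral_const_mul] at hQu
      simp only [backward]
      rw [← h1_def, ← hφ'_def]
      rw [← hI_def] at hQ1 hQl hQu
      rw [← hJ_def] at hQl hQu
      set Q1 := ∫ z, q 0 x z * h1 z ∂base
      set Qφ := ∫ z, q 0 x z * hφ' z ∂base
      have hl0 : 0 ≤ a / b * (J / I - l) :=
        mul_nonneg (by positivity) (sub_nonneg.2 ((le_div_iff₀ hI).2 hlJ))
      have hu0 : 0 ≤ a / b * (u - J / I) :=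
        mul_nonneg (by positivity) (sub_nonneg.2 ((div_le_iff₀ hI).2 huJ))
      have k1 : a / b * (J / I - l) * (b * I) = a * (J - l * I) := by field_simp
      have k2 : a / b * (u - J / I) * (b * I) = a * (u * I - J) := by field_simp
      have m1 := mul_le_mul_of_nonneg_left hQ1 hl0
      have m2 := mul_le_mul_of_nonneg_left hQ1 hu0
      constructor <;> linarith

end Contraction

section TotalVariation

variable {S : Type*} [MeasurableSpace S] {p r : Measure S} [IsFiniteMeasure p]
  [IsFiniteMeasure r]

lemma abs_measureReal_sub_le_tvDist {s : Set S} (hs : MeasurableSet s) :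
    |p.real s - r.real s| ≤ tvDist p r := by
  refine le_ciSup (f := fun s : {s : Set S // MeasurableSet s} =>
    |(p s.1).toReal - (r s.1).toReal|) ⟨p.real Set.univ + r.real Set.univ, ?_⟩ ⟨s, hs⟩
  rintro _ ⟨t, rfl⟩
  refine (abs_sub _ _).trans (add_le_add ?_ ?_) <;>
    exact (abs_of_nonneg ENNReal.toReal_nonneg).trans_le (measureReal_mono (Set.subset_univ _))

lemma abs_integral_sub_le_tvDist {G : S → ℝ} (hG : Measurable G) {K : ℝ} (hK : 0 ≤ K)
    (h0 : ∀ x, 0 ≤ G x) (h1 : ∀ x, G x ≤ K) :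
    |∫ x, G x ∂p - ∫ x, G x ∂r| ≤ K * tvDist p r := by
  have habs (x : S) : |G x| ≤ K := (abs_of_nonneg (h0 x)).trans_le (h1 x)
  have hint (ν : Measure S) [IsFiniteMeasure ν] :
      IntegrableOn (fun t => ν.real {x | t ≤ G x}) (Set.Ioc 0 K) :=
    (AntitoneOn.integrableOn_isCompact isCompact_Icc fun s _ t _ hst =>
      measureReal_mono fun x (hx : t ≤ G x) => hst.trans hx).mono_set Set.Ioc_subset_Icc_self
  rw [(integrable_of_abs_le hG K habs).integral_eq_integral_Ioc_meas_le
      (Filter.Eventually.of_forall h0) (Filter.Eventually.of_forall h1),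
    (integrable_of_abs_le hG K habs).integral_eq_integral_Ioc_meas_le
      (Filter.Eventually.of_forall h0) (Filter.Eventually.of_forall h1),
    ← integral_sub (hint p) (hint r), mul_comm]
  have hb : ∀ t ∈ Set.Ioc 0 K,
      ‖p.real {x | t ≤ G x} - r.real {x | t ≤ G x}‖ ≤ tvDist p r := fun t _ =>
    abs_measureReal_sub_le_tvDist (measurableSet_le measurable_const hG)
  refine (norm_setIntegral_le_of_norm_le_const measure_Ioc_lt_top hb).trans_eq ?_
  simp [hK]

/-- Normalized expectations of `F` relative to a comparable positive weight `H` differ in total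
variation by at most the oscillation of `F / H`. -/
lemma abs_ratio_sub_ratio_le_tvDist [IsProbabilityMeasure p] [NeZero r] {F H : S → ℝ}
    (hF : Measurable F)
    (hH : Measurable H) {m Θ l u : ℝ} (hm : 0 < m) (hΘ : 0 ≤ Θ) (hlu : l ≤ u)
    (hmH : ∀ x, m ≤ H x) (hHm : ∀ x, H x ≤ Θ * m)
    (hl : ∀ x, l * H x ≤ F x) (hu : ∀ x, F x ≤ u * H x) :
    |(∫ x, F x ∂p) / (∫ x, H x ∂p) - (∫ x, F x ∂r) / (∫ x, H x ∂r)| ≤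
      2 * (u - l) * Θ * tvDist p r := by
  have hH0 (x : S) : 0 ≤ H x := hm.le.trans (hmH x)
  have hul : 0 ≤ u - l := sub_nonneg.2 hlu
  have iH (ν : Measure S) [IsFiniteMeasure ν] : Integrable H ν :=
    integrable_of_abs_le hH (Θ * m) fun x => (abs_of_nonneg (hH0 x)).trans_le (hHm x)
  have hG0 (x : S) : 0 ≤ F x - l * H x := sub_nonneg.2 (hl x)
  have hGu (x : S) : F x - l * H x ≤ (u - l) * H x := by linarith [hu x]
  have hG1 (x : S) : F x - l * H x ≤ (u - l) * (Θ * m) :=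
    (hGu x).trans (mul_le_mul_of_nonneg_left (hHm x) hul)
  have hGm : Measurable fun x => F x - l * H x := hF.sub (hH.const_mul l)
  have iG (ν : Measure S) [IsFiniteMeasure ν] : Integrable (fun x => F x - l * H x) ν :=
    integrable_of_abs_le hGm _ fun x => (abs_of_nonneg (hG0 x)).trans_le (hG1 x)
  have eF (ν : Measure S) [IsFiniteMeasure ν] :
      ∫ x, F x ∂ν = ∫ x, (F x - l * H x) ∂ν + l * ∫ x, H x ∂ν := by
    rw [← integral_const_mul, ← integral_add (iG ν) ((iH ν).const_mul l)]
    simp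
  have tG := abs_integral_sub_le_tvDist (p := p) (r := r) hGm (by positivity) hG0 hG1
  have tH := abs_integral_sub_le_tvDist (p := p) (r := r) hH (by positivity) hH0 hHm
  have hP : m ≤ ∫ x, H x ∂p := by
    simpa using integral_mono (integrable_const m) (iH p) hmH
  have hR : 0 < ∫ x, H x ∂r := integral_pos_of_const_le hm (iH r) hmH
  have hRG : ∫ x, (F x - l * H x) ∂r ≤ (u - l) * ∫ x, H x ∂r := by
    rw [← integral_const_mul]
    exact integral_mono (iG r) ((iH r).const_mul _) hGu
  have hRG0 : 0 ≤ ∫ x, (F x - l * H x) ∂r := integral_nonneg hG0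
  rw [eF p, eF r]
  set PG := ∫ x, (F x - l * H x) ∂p
  set RG := ∫ x, (F x - l * H x) ∂r
  set P := ∫ x, H x ∂p
  set R := ∫ x, H x ∂r
  set T := tvDist p r
  have hP0 : 0 < P := hm.trans_le hP
  have key : (PG + l * P) / P - (RG + l * R) / R =
      ((PG - RG) + RG / R * (R - P)) / P := by
    field_simp
    ring
  rw [key, abs_div, abs_of_pos hP0, div_le_iff₀ hP0]
  have hT : 0 ≤ T := (abs_nonneg _).trans (abs_measureReal_sub_le_tvDist MeasurableSet.univ)
  calc |PG - RG + RG / R * (R - P)|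
      ≤ |PG - RG| + RG / R * |P - R| := by
        refine (abs_add_le _ _).trans_eq ?_
        rw [abs_mul, abs_of_nonneg (div_nonneg hRG0 hR.le), abs_sub_comm R P]
    _ ≤ (u - l) * (Θ * m) * T + (u - l) * (Θ * m * T) := by
        gcongr
        rwa [div_le_iff₀ hR]
    _ = 2 * (u - l) * Θ * T * m := by ring
    _ ≤ _ := by gcongr

end TotalVariation

section Densities

variable {S X : Type*} [MeasurableSpace S] [MeasurableSpace X]

lemma integral_normMeasure {base : Measure X} {ρ : X → ℝ} (hρm : Measurable ρ)
    (hρ : ∀ x, 0 ≤ ρ x) (ψ : X → ℝ) :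
    ∫ x, ψ x ∂(normMeasure base ρ) = (∫ x, ρ x * ψ x ∂base) / ∫ x, ρ x ∂base := by
  rw [normMeasure, integral_smul_measure,
    integral_withDensity_eq_integral_toReal_smul hρm.ennreal_ofReal
      (Filter.Eventually.of_forall fun _ => ENNReal.ofReal_lt_top),
    integral_eq_lintegral_of_nonneg_ae (f := ρ) (Filter.Eventually.of_forall hρ)
      hρm.aestronglyMeasurable]
  simp only [ENNReal.toReal_ofReal (hρ _), smul_eq_mul, ENNReal.toReal_inv]
  ring

lemma isProbabilityMeasure_normMeasure {base : Measure X} {ρ : X → ℝ} (hρ : ∀ x, 0 ≤ ρ x)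
    (hint : Integrable ρ base) (hpos : 0 < ∫ x, ρ x ∂base) :
    IsProbabilityMeasure (normMeasure base ρ) := by
  refine ⟨?_⟩
  rw [normMeasure, Measure.smul_apply, withDensity_apply _ MeasurableSet.univ,
    Measure.restrict_univ, smul_eq_mul,
    ← ofReal_integral_eq_lintegral_ofReal hint (Filter.Eventually.of_forall hρ)]
  exact ENNReal.inv_mul_cancel (by simpa using hpos) ENNReal.ofReal_ne_top

lemma integral_map_normMeasure {base : Measure X} {ρ : X → ℝ} (hρm : Measurable ρ)
    (hρ : ∀ x, 0 ≤ ρ x) {T : X → S} (hT : Measurable T) {φ : S → ℝ} (hφ : Measurable φ) :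
    ∫ s, φ s ∂((normMeasure base ρ).map T) = (∫ x, ρ x * φ (T x) ∂base) / ∫ x, ρ x ∂base := by
  rw [integral_map hT.aemeasurable hφ.aestronglyMeasurable, integral_normMeasure hρm hρ]

variable {base : Measure S} {d : S → ℝ} {a b : ℝ}

lemma integral_withDensity_ofReal (hd : Measurable d) (hd0 : ∀ x, 0 ≤ d x) (ψ : S → ℝ) :
    ∫ x, ψ x ∂(base.withDensity fun x => ENNReal.ofReal (d x)) = ∫ x, d x * ψ x ∂base := by
  rw [integral_withDensity_eq_integral_toReal_smul hd.ennreal_ofReal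
      (Filter.Eventually.of_forall fun _ => ENNReal.ofReal_lt_top)]
  simp only [ENNReal.toReal_ofReal (hd0 _), smul_eq_mul]

lemma neZero_withDensity_ofReal [NeZero base] (hd : Measurable d) (hd0 : ∀ x, 0 < d x) :
    NeZero (base.withDensity fun x => ENNReal.ofReal (d x)) := by
  refine ⟨fun h => ?_⟩
  rw [withDensity_eq_zero_iff hd.ennreal_ofReal.aemeasurable] at h
  obtain ⟨x, hx⟩ := h.exists
  exact absurd hx (by simpa using hd0 x)

end Densities

section Filtering

variable {S Y : Type*} [MeasurableSpace S] {f : S → S → ℝ} {g : S → Y → ℝ} {α β : ℝ}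

/-- Transition and likelihood densities, measurable and with values in `[α, β]`, `0 < α`. -/
structure IsBddPosModel (f : S → S → ℝ) (g : S → Y → ℝ) (α β : ℝ) : Prop where
  pos : 0 < α
  measurable_transition : Measurable (Function.uncurry f)
  measurable_likelihood : ∀ t, Measurable fun z => g z t
  transition_mem : ∀ x z, f x z ∈ Set.Icc α β
  likelihood_mem : ∀ z t, g z t ∈ Set.Icc α β

lemma mul_mem_Icc_sq {s t : ℝ} (hα : 0 < α) (hs : s ∈ Set.Icc α β) (ht : t ∈ Set.Icc α β) :
    s * t ∈ Set.Icc (α ^ 2) (β ^ 2) := by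
  have h0 : 0 ≤ β := hα.le.trans (hs.1.trans hs.2)
  constructor <;> rw [sq]
  · exact mul_le_mul hs.1 ht.1 hα.le (hα.le.trans hs.1)
  · exact mul_le_mul hs.2 ht.2 (hα.le.trans ht.1) h0

/-- The likelihood at time `s + 1` times the backward recursion over the next `k` steps. -/
noncomputable def blockWeight (base : Measure S) (f : S → S → ℝ) (g : S → Y → ℝ) (y : ℕ → Y)
    (s k : ℕ) (φ : S → ℝ) (z : S) : ℝ :=
  g z (y (s + 1)) * backward base (stepKernel f g y (s + 1)) k φ z

namespace IsBddPosModel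

lemma isBddPosKernel_step (h : IsBddPosModel f g α β) (y : ℕ → Y) (s : ℕ) :
    IsBddPosKernel (stepKernel f g y s) (α ^ 2) (β ^ 2) where
  measurable _ := h.measurable_transition.mul ((h.measurable_likelihood _).comp measurable_snd)
  pos := pow_pos h.pos 2
  mem_Icc _ x z := mul_mem_Icc_sq h.pos (h.transition_mem x z) (h.likelihood_mem z _)

lemma isBddPosKernel_lagged (h : IsBddPosModel f g α β) {w : S → ℝ} (hw : Measurable w)
    (hwm : ∀ x, w x ∈ Set.Icc α β) (y : ℕ → Y) (s : ℕ) :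
    IsBddPosKernel (laggedKernel f g w y s) (α ^ 2) (β ^ 2) where
  measurable i := by
    cases i with
    | zero => exact (hw.comp measurable_snd).mul ((h.measurable_likelihood _).comp measurable_snd)
    | succ i =>
      exact h.measurable_transition.mul ((h.measurable_likelihood _).comp measurable_snd)
  pos := pow_pos h.pos 2
  mem_Icc i x z := by
    cases i with
    | zero => exact mul_mem_Icc_sq h.pos (hwm z) (h.likelihood_mem z _)
    | succ i => exact mul_mem_Icc_sq h.pos (h.transition_mem x z) (h.likelihood_mem z _)

lemma abs_transition_le (h : IsBddPosModel f g α β) (x z : S) : |f x z| ≤ β :=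
  (abs_of_nonneg (h.pos.le.trans (h.transition_mem x z).1)).trans_le (h.transition_mem x z).2

lemma abs_likelihood_le (h : IsBddPosModel f g α β) (z : S) (t : Y) : |g z t| ≤ β :=
  (abs_of_nonneg (h.pos.le.trans (h.likelihood_mem z t).1)).trans_le (h.likelihood_mem z t).2

end IsBddPosModel

lemma filterMarginal_eq (base : Measure S) (f : S → S → ℝ) (g : S → Y → ℝ) (x0 : S) (y : ℕ → Y) (n : ℕ)
    (hn : 1 ≤ n) :
    filterMarginal base f g x0 y n hn = (normMeasure (Measure.pi fun _ : Fin n => base)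
        (fun x => pathWeight (stepKernel f g y 0) x0 x)).map fun x => finalState x0 x := by
  rw [filterMarginal, finalState_of_pos x0 hn]
  congr 2
  funext x
  simp [smoothDensity, pathWeight, stepKernel]

variable (base : Measure S) [IsFiniteMeasure base]

lemma integral_map_finalState {q : ℕ → S → S → ℝ} {a b : ℝ} (hq : IsBddPosKernel q a b)
    {φ : S → ℝ} (hφ : Measurable φ) {M : ℝ} (hM : ∀ x, |φ x| ≤ M) (x0 : S) (n : ℕ) :
    ∫ s, φ s ∂((normMeasure (Measure.pi fun _ : Fin n => base)
        (fun x => pathWeight q x0 x)).map fun x => finalState x0 x) =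
      backward base q n φ x0 / backward base q n (fun _ => 1) x0 := by
  rw [integral_map_normMeasure (measurable_pathWeight hq x0 n) (pathWeight_nonneg hq x0)
    (measurable_finalState x0 n) hφ, integral_pathWeight_mul base hq hφ hM]
  congr 1
  simpa using integral_pathWeight_mul base hq (φ := fun _ => 1) measurable_const (M := 1)
    (by simp) x0 n

lemma backward_one_pos [NeZero base] {q : ℕ → S → S → ℝ} {a b : ℝ} (hq : IsBddPosKernel q a b)
    (n : ℕ) (x : S) : 0 < backward base q n (fun _ => 1) x :=
  let ⟨_, hm, h⟩ := exists_backward_one_bounds base hq n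
  hm.trans_le (h x).1

variable {base}

namespace IsBddPosModel

lemma integral_filterMarginal (h : IsBddPosModel f g α β) (x0 : S) (y : ℕ → Y) {n : ℕ}
    (hn : 1 ≤ n) {φ : S → ℝ} (hφ : Measurable φ) {M : ℝ} (hM : ∀ x, |φ x| ≤ M) :
    ∫ s, φ s ∂(filterMarginal base f g x0 y n hn) =
      backward base (stepKernel f g y 0) n φ x0 /
        backward base (stepKernel f g y 0) n (fun _ => 1) x0 := by
  rw [filterMarginal_eq, integral_map_finalState base (h.isBddPosKernel_step y 0) hφ hM]

lemma measurable_blockWeight (h : IsBddPosModel f g α β) (y : ℕ → Y) (s k : ℕ) {φ : S → ℝ}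
    (hφ : Measurable φ) : Measurable (blockWeight base f g y s k φ) :=
  (h.measurable_likelihood _).mul (measurable_backward base (h.isBddPosKernel_step y (s + 1)) hφ k)

lemma exists_abs_blockWeight_le (h : IsBddPosModel f g α β) (y : ℕ → Y) (s k : ℕ) {φ : S → ℝ}
    {M : ℝ} (hM : ∀ x, |φ x| ≤ M) : ∃ K, ∀ x, |blockWeight base f g y s k φ x| ≤ K := by
  obtain ⟨K, hK⟩ := exists_abs_backward_le base (h.isBddPosKernel_step y (s + 1)) hM k
  refine ⟨β * K, fun x => ?_⟩
  rw [blockWeight, abs_mul]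
  exact mul_le_mul (h.abs_likelihood_le x _) (hK x) (abs_nonneg _)
    ((abs_nonneg _).trans (h.abs_likelihood_le x (y 0)))

variable [NeZero base]

lemma isProbabilityMeasure_filterMarginal (h : IsBddPosModel f g α β) (x0 : S)
    (y : ℕ → Y) {n : ℕ} (hn : 1 ≤ n) :
    IsProbabilityMeasure (filterMarginal base f g x0 y n hn) := by
  have hq := h.isBddPosKernel_step y 0
  have e := integral_pathWeight_mul base hq (φ := fun _ => 1) measurable_const (M := 1)
    (by simp) x0 n
  have i := integrable_pathWeight_mul base hq (φ := fun _ => 1) measurable_const (M := 1)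
    (by simp) x0 n
  simp only [mul_one] at e i
  have := isProbabilityMeasure_normMeasure (pathWeight_nonneg hq x0) i
    (e ▸ backward_one_pos base hq n x0)
  rw [filterMarginal_eq]
  exact Measure.isProbabilityMeasure_map (measurable_finalState x0 n).aemeasurable

lemma integral_laggedFilterMarginal (h : IsBddPosModel f g α β) {μ : ℕ → S → ℝ}
    (hμ : ∀ k, Measurable (μ k)) (hμm : ∀ k x, μ k x ∈ Set.Icc α β) (y : ℕ → Y) (x0 : S)
    {k n : ℕ} {φ : S → ℝ} (hφ : Measurable φ) {M : ℝ} (hM : ∀ x, |φ x| ≤ M) :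
    ∫ s, φ s ∂(laggedFilterMarginal base f g μ y (k + 1) n (Nat.le_add_left 1 k)) =
      (∫ z, blockWeight base f g y (n - (k + 1)) k φ z
        ∂(normMeasure base (μ (n - (k + 1))))) /
      ∫ z, blockWeight base f g y (n - (k + 1)) k (fun _ => 1) z
        ∂(normMeasure base (μ (n - (k + 1)))) := by
  have h0 (x : S) : 0 ≤ μ (n - (k + 1)) x := h.pos.le.trans (hμm _ x).1
  have hq := h.isBddPosKernel_lagged (hμ (n - (k + 1))) (hμm _) y (n - (k + 1))
  have e (ψ : S → ℝ) :
      backward base (laggedKernel f g (μ (n - (k + 1))) y (n - (k + 1))) (k + 1) ψ x0 =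
        ∫ z, μ (n - (k + 1)) z * blockWeight base f g y (n - (k + 1)) k ψ z ∂base := by
    simp only [backward, laggedKernel, blockWeight, mul_assoc]
    rfl
  have hpos : 0 < ∫ z, μ (n - (k + 1)) z ∂base :=
    integral_pos_of_const_le h.pos (integrable_of_abs_le (hμ _) β fun x =>
      (abs_of_nonneg (h0 x)).trans_le (hμm _ x).2) fun x => (hμm _ x).1
  rw [laggedFilterMarginal, finalState_of_pos x0 (Nat.le_add_left 1 k),
    funext (laggedBlockDensity_eq_pathWeight f g μ y (k + 1) n _ x0),
    integral_map_finalState base hq hφ hM, e, e, integral_normMeasure (hμ _) h0,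
    integral_normMeasure (hμ _) h0, div_div_div_cancel_right₀ hpos.ne']

lemma predictive_density_mem (h : IsBddPosModel f g α β) (π : Measure S) [IsProbabilityMeasure π]
    (x : S) : ∫ z, f z x ∂π ∈ Set.Icc α β := by
  have hi : Integrable (fun z => f z x) π :=
    integrable_of_abs_le (h.measurable_transition.comp measurable_prodMk_right) β
      fun z => h.abs_transition_le z x
  constructor
  · simpa using integral_mono (integrable_const α) hi fun z => (h.transition_mem z x).1
  · simpa using integral_mono hi (integrable_const β) fun z => (h.transition_mem z x).2

lemma measurable_predictive_density (h : IsBddPosModel f g α β) (π : Measure S)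
    [IsProbabilityMeasure π] : Measurable fun x => ∫ z, f z x ∂π :=
  (h.measurable_transition.comp measurable_swap).stronglyMeasurable.integral_prod_right
    (f := fun x z => f z x) |>.measurable

lemma isFiniteMeasure_predictiveMeasure (h : IsBddPosModel f g α β) (x0 : S) (y : ℕ → Y) {s : ℕ}
    (hs : 1 ≤ s) : IsFiniteMeasure (predictiveMeasure base f g x0 y s hs) := by
  have := h.isProbabilityMeasure_filterMarginal (base := base) x0 y hs
  have hd := h.predictive_density_mem (filterMarginal base f g x0 y s hs)
  exact isFiniteMeasure_withDensity_ofReal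
    (integrable_of_abs_le (h.measurable_predictive_density _) β fun x =>
      (abs_of_nonneg (h.pos.le.trans (hd x).1)).trans_le (hd x).2).2

lemma neZero_predictiveMeasure (h : IsBddPosModel f g α β) (x0 : S) (y : ℕ → Y) {s : ℕ}
    (hs : 1 ≤ s) : NeZero (predictiveMeasure base f g x0 y s hs) := by
  have := h.isProbabilityMeasure_filterMarginal (base := base) x0 y hs
  exact neZero_withDensity_ofReal (h.measurable_predictive_density _) fun x =>
    h.pos.trans_le (h.predictive_density_mem _ x).1

/-- The filter recursion from time `s` to time `s + k + 1`, before normalization. -/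
lemma integral_blockWeight_predictiveMeasure (h : IsBddPosModel f g α β) (x0 : S) (y : ℕ → Y)
    {s : ℕ} (hs : 1 ≤ s) (k : ℕ) {φ : S → ℝ} (hφ : Measurable φ) {M : ℝ}
    (hM : ∀ x, |φ x| ≤ M) :
    ∫ z, blockWeight base f g y s k φ z ∂(predictiveMeasure base f g x0 y s hs) =
      backward base (stepKernel f g y 0) (s + (k + 1)) φ x0 /
        backward base (stepKernel f g y 0) s (fun _ => 1) x0 := by
  have := h.isProbabilityMeasure_filterMarginal (base := base) x0 y hs
  have hshift (j : ℕ) : (fun i => stepKernel f g y 0 (i + j)) = stepKernel f g y j := by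
    funext i x z
    simp only [stepKernel, zero_add, add_comm i j]
  have hshift' : (fun i => stepKernel f g y s (i + 1)) = stepKernel f g y (s + 1) := by
    funext i x z
    simp only [stepKernel, add_assoc, add_comm i 1]
  obtain ⟨K, hK⟩ := exists_abs_backward_le base (h.isBddPosKernel_step y s) hM (k + 1)
  obtain ⟨K', hK'⟩ := h.exists_abs_blockWeight_le (base := base) y s k hM
  have hm := h.measurable_blockWeight (base := base) y s k hφ
  rw [backward_add, hshift, ← h.integral_filterMarginal x0 y hs
      (measurable_backward base (h.isBddPosKernel_step y s) hφ (k + 1)) hK,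
    predictiveMeasure, integral_withDensity_ofReal (h.measurable_predictive_density _)
      fun x => h.pos.le.trans (h.predictive_density_mem _ x).1]
  simp only [backward, hshift', ← integral_mul_const]
  rw [integral_integral_swap]
  · congr 1
    funext x
    congr 1
    funext z
    simp only [blockWeight, stepKernel, add_zero, mul_assoc]
  · refine integrable_of_abs_le
      ((h.measurable_transition.comp measurable_swap).mul (hm.comp measurable_fst)) (β * K')
      fun x => ?_
    rw [Function.uncurry, abs_mul]
    exact mul_le_mul (h.abs_transition_le _ _) (hK' _) (abs_nonneg _)
      ((abs_nonneg _).trans (h.abs_transition_le x.1 x.1))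

lemma integral_filterMarginal_add (h : IsBddPosModel f g α β) (x0 : S) (y : ℕ → Y)
    {s k n : ℕ} (hs : 1 ≤ s) (hn : n = s + (k + 1)) (hn1 : 1 ≤ n) {φ : S → ℝ}
    (hφ : Measurable φ) {M : ℝ} (hM : ∀ x, |φ x| ≤ M) :
    ∫ x, φ x ∂(filterMarginal base f g x0 y n hn1) =
      (∫ z, blockWeight base f g y s k φ z ∂(predictiveMeasure base f g x0 y s hs)) /
      ∫ z, blockWeight base f g y s k (fun _ => 1) z
        ∂(predictiveMeasure base f g x0 y s hs) := by
  subst hn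
  rw [h.integral_filterMarginal x0 y hn1 hφ hM,
    h.integral_blockWeight_predictiveMeasure x0 y hs k hφ hM,
    h.integral_blockWeight_predictiveMeasure x0 y hs k measurable_const (M := 1) (by simp),
    div_div_div_cancel_right₀ (backward_one_pos base (h.isBddPosKernel_step y 0) s x0).ne']

/-- The bias of the lagged filter, with explicit constants. -/
theorem abs_integral_lagged_sub_filter_le (h : IsBddPosModel f g α β) {μ : ℕ → S → ℝ}
    (hμ : ∀ k, Measurable (μ k)) (hμm : ∀ k x, μ k x ∈ Set.Icc α β) (y : ℕ → Y) (x0 : S)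
    (L n : ℕ) (hL : 1 ≤ L) (hn : 1 ≤ n) (hs : 1 ≤ n - L) {φ : S → ℝ} (hφ : Measurable φ) {M : ℝ}
    (hM : ∀ x, |φ x| ≤ M) :
    |(∫ x, φ x ∂(laggedFilterMarginal base f g μ y L n hL)) -
        ∫ x, φ x ∂(filterMarginal base f g x0 y n hn)| ≤
      2 * (2 * M * (1 - α ^ 2 / β ^ 2) ^ (L - 1)) * (β / α * (β ^ 2 / α ^ 2)) *
        tvDist (normMeasure base (μ (n - L))) (predictiveMeasure base f g x0 y (n - L) hs) := by
  obtain ⟨k, rfl⟩ : ∃ k, L = k + 1 := ⟨L - 1, by omega⟩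
  have hα := h.pos
  have hβ : 0 < β := hα.trans_le ((h.transition_mem x0 x0).1.trans (h.transition_mem x0 x0).2)
  rw [h.integral_laggedFilterMarginal hμ hμm y x0 hφ hM,
    h.integral_filterMarginal_add (k := k) x0 y hs (by omega) hn hφ hM]
  set s := n - (k + 1)
  have hq := h.isBddPosKernel_step y (s + 1)
  obtain ⟨m, hm, hb⟩ := exists_backward_one_bounds base hq k
  obtain ⟨l, u, hlu, hd, hr⟩ := exists_backward_ratio_bounds base hq hφ hM k
  have h0 (x : S) : 0 ≤ μ s x := hα.le.trans (hμm s x).1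
  have hi : Integrable (μ s) base := integrable_of_abs_le (hμ s) β fun x =>
    (abs_of_nonneg (h0 x)).trans_le (hμm s x).2
  have := isProbabilityMeasure_normMeasure h0 hi
    (integral_pos_of_const_le hα hi fun x => (hμm s x).1)
  have := h.isFiniteMeasure_predictiveMeasure (base := base) x0 y hs
  have := h.neZero_predictiveMeasure (base := base) x0 y hs
  have hg (x : S) := h.likelihood_mem x (y (s + 1))
  refine (abs_ratio_sub_ratio_le_tvDist (h.measurable_blockWeight y s k hφ)
    (h.measurable_blockWeight y s k measurable_const) (m := α * m)
    (Θ := β / α * (β ^ 2 / α ^ 2)) (l := l) (u := u) (by positivity) (by positivity) hlu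
    (fun x => ?_) (fun x => ?_) (fun x => ?_) fun x => ?_).trans ?_
  · exact mul_le_mul (hg x).1 (hb x).1 hm.le (hα.le.trans (hg x).1)
  · refine (mul_le_mul (hg x).2 (hb x).2 (hm.le.trans (hb x).1) hβ.le).trans_eq ?_
    field_simp
  · rw [blockWeight, blockWeight, mul_left_comm]
    exact mul_le_mul_of_nonneg_left (hr x).1 (hα.le.trans (hg x).1)
  · rw [blockWeight, blockWeight, mul_left_comm]
    exact mul_le_mul_of_nonneg_left (hr x).2 (hα.le.trans (hg x).1)
  · have hT := (abs_nonneg _).trans (abs_measureReal_sub_le_tvDist (p := normMeasure base (μ s))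
      (r := predictiveMeasure base f g x0 y s hs) MeasurableSet.univ)
    gcongr
    simpa using hd

end IsBddPosModel

end Filtering

/-- Proposition 3.2(ii): exponential-in-`L` bias bound for the single-coordinate
lagged filter. If `ḡ, f̄` take values in `[c,C]` and `|μ̄_k| ≤ C`, then there exist `ρ ∈ (0,1)`
and `C' < ∞`, depending only on `c`, `C` and `E`, such that for all `n ≥ L+1` and all bounded
measurable `φ`,
`|π̃_{1,n,n}(φ) − π_{(n)}(φ)| ≤ C' ‖φ‖_∞ ‖μ̄^e_{n-L} − π_{(n-L+1|n-L)}‖_TV ρ^L`. -/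
theorem lagged_filter_bias_bound_single_coordinate :
    ∀ (E : Set ℝ), IsCompact E → 0 < MeasureTheory.volume E →
    ∀ (c C : ℝ), 0 < c → c ≤ C →
    ∃ ρ : ℝ, ρ ∈ Set.Ioo (0:ℝ) 1 ∧
    ∃ C' : ℝ, 0 ≤ C' ∧
      ∀ (Y : Type) (_ : MeasurableSpace Y) (x0 : ↥E) (y : ℕ → Y)
        (gbar : ↥E → Y → ℝ) (fbar : ↥E → ↥E → ℝ) (μbar : ℕ → ↥E → ℝ),
        Measurable (Function.uncurry gbar) → Measurable (Function.uncurry fbar) →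
        (∀ k, Measurable (μbar k)) →
        (∀ a b, gbar a b ∈ Set.Icc c C) → (∀ a b, fbar a b ∈ Set.Icc c C) →
        (∀ k a, |μbar k a| ≤ C) →
      ∀ (L n : ℕ) (hL : 1 ≤ L) (hn : L + 1 ≤ n),
      ∀ (φ : ↥E → ℝ) (Mφ : ℝ), Measurable φ → (∀ a, |φ a| ≤ Mφ) →
        |(∫ a, φ a ∂(laggedFilterMarginal (subMeasure E)
              (fun a b => Real.exp (fbar a b)) (fun a b => Real.exp (gbar a b))
              (fun k a => Real.exp (μbar k a)) y L n hL)) -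
          ∫ a, φ a ∂(filterMarginal (subMeasure E)
              (fun a b => Real.exp (fbar a b)) (fun a b => Real.exp (gbar a b)) x0 y n
              (by omega))| ≤
        C' * Mφ *
          tvDist (normMeasure (subMeasure E) (fun a => Real.exp (μbar (n - L) a)))
            (predictiveMeasure (subMeasure E)
              (fun a b => Real.exp (fbar a b)) (fun a b => Real.exp (gbar a b)) x0 y (n - L)
              (by omega)) *
          ρ ^ L := by
  intro E hE hE0 c C hc hcC
  have hC : 0 < C := hc.trans_le hcC
  have hfin : IsFiniteMeasure (subMeasure E) := by
    refine ⟨?_⟩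
    rw [subMeasure, comap_subtype_coe_apply hE.measurableSet, Subtype.coe_image_univ]
    exact hE.measure_lt_top
  have hne : NeZero (subMeasure E) := by
    refine ⟨fun h => hE0.ne' ?_⟩
    have h1 := congrArg (fun ν => ν Set.univ) h
    simpa [subMeasure, comap_subtype_coe_apply hE.measurableSet] using h1
  have hratio : Real.exp (-C) ^ 2 / Real.exp C ^ 2 < 1 := by
    rw [div_lt_one (by positivity)]
    have : Real.exp (-C) < Real.exp C := Real.exp_lt_exp.2 (by linarith)
    gcongr
  have hratio0 : 0 < Real.exp (-C) ^ 2 / Real.exp C ^ 2 := by positivity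
  set ρ := 1 - Real.exp (-C) ^ 2 / Real.exp C ^ 2 with hρ
  have hρ0 : 0 < ρ := by linarith
  set Θ := Real.exp C / Real.exp (-C) * (Real.exp C ^ 2 / Real.exp (-C) ^ 2)
  refine ⟨ρ, ⟨hρ0, by linarith⟩, 4 * Θ / ρ, by positivity, ?_⟩
  intro Y _ x0 y gbar fbar μbar hg hf hμ hgm hfm hμm L n hL hn φ M hφ hM
  have hexp {t : ℝ} (ht : t ∈ Set.Icc c C) :
      Real.exp t ∈ Set.Icc (Real.exp (-C)) (Real.exp C) :=
    ⟨Real.exp_le_exp.2 (by linarith [ht.1]), Real.exp_le_exp.2 ht.2⟩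
  have hmodel : IsBddPosModel (fun a b => Real.exp (fbar a b))
      (fun a b => Real.exp (gbar a b)) (Real.exp (-C)) (Real.exp C) :=
    { pos := Real.exp_pos _
      measurable_transition := Real.measurable_exp.comp hf
      measurable_likelihood := fun t =>
        Real.measurable_exp.comp (hg.comp measurable_prodMk_right)
      transition_mem := fun x z => hexp (hfm x z)
      likelihood_mem := fun z t => hexp (hgm z t) }
  refine (hmodel.abs_integral_lagged_sub_filter_le (base := subMeasure E)
    (μ := fun k a => Real.exp (μbar k a)) (fun k => Real.measurable_exp.comp (hμ k))
    (fun k x => ⟨Real.exp_le_exp.2 (abs_le.1 (hμm k x)).1,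
      Real.exp_le_exp.2 (abs_le.1 (hμm k x)).2⟩)
    y x0 L n hL (by omega) (by omega) hφ hM).trans_eq ?_
  obtain ⟨k, rfl⟩ : ∃ k, L = k + 1 := ⟨L - 1, by omega⟩
  change 2 * (2 * M * ρ ^ k) * Θ * tvDist _ _ = _
  field_simp
  ring
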